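/- Let {D_{i,j,k}} be a family of real numbers indexed by the 3-element subsets of [5] = {1,2,3,4,5}. There exists a weighted tree T (edges weighted by arbitrary real numbers) with leaf set [5] such that D_{i,j,k} = D_{i,j,k}(T) for every 3-subset {i,j,k} of [5] if and only if there exist four distinct elements α, α′, β, β′ ∈ [5] such that both conditions ∗^{α,α′} and ∗^{β,β′} hold. -/

import Mathlib

/-- A weighted tree whose leaves are labeled bijectively by `Fin n`. -/
structure WeightedTree (n : ℕ) where
  V : Type
  [fintypeV : Fintype V]
  [decEqV : DecidableEq V]
  G : SimpleGraph V
  [decAdj : DecidableRel G.Adj]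
  isTree : G.IsTree
  w : Sym2 V → ℝ
  leaf : Fin n → V
  leaf_inj : Function.Injective leaf
  leaf_iff : ∀ v : V, (∃ i, leaf i = v) ↔ G.degree v ≤ 1

attribute [instance] WeightedTree.fintypeV WeightedTree.decEqV WeightedTree.decAdj

namespace WeightedTree

variable {n : ℕ}

/-- The unique path between two vertices of a tree. -/
noncomputable def treePath (T : WeightedTree n) (u v : T.V) : T.G.Walk u v :=
  (T.isTree.existsUnique_path u v).choose

/-- The sum of the weights of the edges on the path from `u` to `v`. -/
noncomputable def pathWeight (T : WeightedTree n) (u v : T.V) : ℝ :=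
  ((T.treePath u v).edges.map T.w).sum

open Classical in
/-- The total weight of the minimal subtree spanning the leaves indexed by `S`:
the sum of the weights of the edges lying on a path between two leaves of `S`. -/
noncomputable def D (T : WeightedTree n) (S : Finset (Fin n)) : ℝ :=
  ∑ e ∈ T.G.edgeFinset.filter
      (fun e => ∃ i ∈ S, ∃ j ∈ S, e ∈ (T.treePath (T.leaf i) (T.leaf j)).edges),
    T.w e

/-- All edge weights are positive. -/
def PosWeights (T : WeightedTree n) : Prop := ∀ e ∈ T.G.edgeSet, 0 < T.w e

/-- Two leaves are neighbours (form a cherry) if the path between them contains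
exactly one vertex of degree at least 3. -/
def Neighbours (T : WeightedTree n) (a b : Fin n) : Prop :=
  ∃! z : T.V, z ∈ (T.treePath (T.leaf a) (T.leaf b)).support ∧ 3 ≤ T.G.degree z

end WeightedTree

open WeightedTree

/-- Condition `∗^{a,b}` for a family of real numbers indexed by the `3`-subsets
of `Fin m`: `D {a,x,y} - D {b,x,y}` does not depend on the choice of the
distinct `x, y ∉ {a,b}`. -/
def StarTriple {m : ℕ} (D : Finset (Fin m) → ℝ) (a b : Fin m) : Prop :=
  ∃ c : ℝ, ∀ x y : Fin m, x ≠ y → x ≠ a → x ≠ b → y ≠ a → y ≠ b →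
    D {a, x, y} - D {b, x, y} = c

/-- Two splits are compatible if one of the four intersections of their sides
is empty. -/
def CompatibleSplits {ι : Type*} (c d : ι → Bool) : Prop :=
  ∃ p q, ∀ i, ¬(c i = p ∧ d i = q)

namespace SimpleGraph

variable {V : Type*} {G : SimpleGraph V}

/-- A two-colouring of the vertices whose only bichromatic edge is `e`. -/
def IsSplit (G : SimpleGraph V) (e : Sym2 V) (c : V → Bool) : Prop :=
  ∀ x y, G.Adj x y → (c x ≠ c y ↔ s(x, y) = e)

theorem IsSplit.mem_edges_iff {e : Sym2 V} {c : V → Bool} (hc : G.IsSplit e c) {x y : V}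
    (p : G.Walk x y) (hp : p.IsTrail) : e ∈ p.edges ↔ c x ≠ c y := by
  induction p with
  | nil => simp
  | cons h p ih =>
    rw [Walk.isTrail_cons] at hp
    have h1 := ih hp.1
    have h2 := hc _ _ h
    have h3 := hp.2
    rw [Walk.edges_cons, List.mem_cons]
    grind

theorem IsSplit.eq_of_mem_support {e : Sym2 V} {c : V → Bool} (hc : G.IsSplit e c) {x y : V}
    (p : G.Walk x y) (hp : e ∉ p.edges) {z : V} (hz : z ∈ p.support) : c z = c x := by
  induction p with
  | nil => simp_all
  | cons h p ih =>
    have h2 := hc _ _ h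
    rw [Walk.edges_cons, List.mem_cons] at hp
    rw [Walk.support_cons, List.mem_cons] at hz
    grind

theorem IsSplit.compatible (hG : G.Connected) {e f : Sym2 V} {c d : V → Bool}
    (hc : G.IsSplit e c) (hd : G.IsSplit f d) (hf : f ∈ G.edgeSet) (hef : e ≠ f) :
    CompatibleSplits c d := by
  classical
  induction f with | _ x y =>
  rw [mem_edgeSet] at hf
  by_cases h : ∃ a, c a = !c x
  · obtain ⟨a, ha⟩ := h
    refine ⟨!c x, !d a, fun b ⟨hb, hb'⟩ => ?_⟩
    obtain ⟨p, hp⟩ := (hG a b).exists_isPath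
    have he : e ∉ p.edges := by
      rw [hc.mem_edges_iff p hp.isTrail, ha, hb]; simp
    have hfp : s(x, y) ∈ p.edges := by
      rw [hd.mem_edges_iff p hp.isTrail, hb']; simp
    have := hc.eq_of_mem_support p he (p.fst_mem_support_of_mem_edges hfp)
    simp [ha] at this
  · exact ⟨!c x, true, fun i hi => h ⟨i, hi.1⟩⟩

theorem IsAcyclic.exists_isSplit (hG : G.IsAcyclic) {e : Sym2 V} (he : e ∈ G.edgeSet) :
    ∃ c, G.IsSplit e c := by
  classical
  have hb := (isAcyclic_iff_forall_isBridge.1 hG) he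
  induction e with | _ u v =>
  rw [isBridge_iff] at hb
  refine ⟨fun x => decide ((G.deleteEdges {s(u, v)}).Reachable u x), fun x y hxy => ?_⟩
  have key : s(x, y) ≠ s(u, v) → ((G.deleteEdges {s(u, v)}).Reachable u x ↔
      (G.deleteEdges {s(u, v)}).Reachable u y) := fun hne => by
    have hadj : (G.deleteEdges {s(u, v)}).Adj x y := by
      rw [deleteEdges_adj]; exact ⟨hxy, hne⟩
    exact ⟨fun h => h.trans hadj.reachable, fun h => h.trans hadj.symm.reachable⟩
  constructor
  · intro h
    by_contra hne
    exact h (by simp only [key hne])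
  · intro h
    rcases Sym2.eq_iff.1 h with ⟨rfl, rfl⟩ | ⟨rfl, rfl⟩ <;> simp_all

end SimpleGraph

open SimpleGraph

/-- The set `S` meets both sides of the split `c`. -/
def Separates {ι : Type*} (c : ι → Bool) (S : Finset ι) : Prop :=
  ∃ i ∈ S, ∃ j ∈ S, c i ≠ c j

instance {ι : Type*} (c : ι → Bool) (S : Finset ι) : Decidable (Separates c S) := by
  unfold Separates; infer_instance

theorem WeightedTree.D_eq_sum {n : ℕ} (T : WeightedTree n) (c : Sym2 T.V → T.V → Bool)
    (hc : ∀ e ∈ T.G.edgeSet, T.G.IsSplit e (c e)) (S : Finset (Fin n)) :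
    T.D S = ∑ e ∈ T.G.edgeFinset, if Separates (c e ∘ T.leaf) S then T.w e else 0 := by
  classical
  unfold WeightedTree.D
  rw [Finset.sum_filter]
  refine Finset.sum_congr rfl fun e he => ?_
  have hs := hc e (mem_edgeFinset.1 he)
  have h (i j) := hs.mem_edges_iff (T.treePath (T.leaf i) (T.leaf j))
    (T.isTree.existsUnique_path _ _).choose_spec.1.isTrail
  simp only [h]
  congr 1

/-- The split `c` either does not separate `a` from `b`, or all the other points lie on the
same side. -/
def SplitRespects {ι : Type*} (c : ι → Bool) (a b : ι) : Prop :=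
  c a = c b ∨ ∀ x y, x ≠ a → x ≠ b → y ≠ a → y ≠ b → c x = c y

theorem SplitRespects.exists_const {ι : Type*} [DecidableEq ι] {c : ι → Bool} {a b : ι}
    (h : SplitRespects c a b) (w : ℝ) : ∃ k : ℝ, ∀ x y, x ≠ a → x ≠ b → y ≠ a → y ≠ b →
      (if Separates c {a, x, y} then w else 0) - (if Separates c {b, x, y} then w else 0) = k := by
  have hsep (a x y) : Separates c {a, x, y} ↔ ¬(c a = c x ∧ c a = c y) := by
    simp only [Separates, Finset.mem_insert, Finset.mem_singleton]
    grind
  simp only [hsep]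
  rcases h with h | h
  · exact ⟨0, fun x y _ _ _ _ => by simp [h]⟩
  by_cases hab : c a = c b
  · exact ⟨0, fun x y _ _ _ _ => by simp [hab]⟩
  by_cases hz : ∃ z, z ≠ a ∧ z ≠ b ∧ c z = c a
  · refine ⟨-w, fun x y _ _ _ _ => ?_⟩
    grind
  · refine ⟨w, fun x y hxa hxb hya hyb => ?_⟩
    have hx : c x = c b := by
      have : c x ≠ c a := fun hx => hz ⟨x, hxa, hxb, hx⟩
      revert this hab
      cases c x <;> cases c a <;> cases c b <;> simp
    have hy := h y x hya hyb hxa hxb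
    simp [hx, hy, hab]

/-- One side of the split `c` is exactly `{a, b}`. -/
def IsCherry {ι : Type*} (c : ι → Bool) (a b : ι) : Prop :=
  a ≠ b ∧ c a = c b ∧ ∀ x, x ≠ a → x ≠ b → c x = !c a

/-- The pairs `{a, b}` and `{x, y}` are equal or disjoint. -/
def PairsNested {ι : Type*} (a b x y : ι) : Prop :=
  (x = a ∧ y = b) ∨ (x = b ∧ y = a) ∨ (x ≠ a ∧ x ≠ b ∧ y ≠ a ∧ y ≠ b)

instance (c : Fin 5 → Bool) (a b : Fin 5) : Decidable (SplitRespects c a b) := by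
  unfold SplitRespects; infer_instance

instance (c : Fin 5 → Bool) (a b : Fin 5) : Decidable (IsCherry c a b) := by
  unfold IsCherry; infer_instance

instance (a b x y : Fin 5) : Decidable (PairsNested a b x y) := by
  unfold PairsNested; infer_instance

theorem SplitRespects.of_forall_isCherry {c : Fin 5 → Bool} {a b : Fin 5} (hab : a ≠ b)
    (h : ∀ x y, IsCherry c x y → PairsNested a b x y) : SplitRespects c a b := by
  have key : ∀ (c : Fin 5 → Bool) (a b : Fin 5), a ≠ b →
      (∀ x y, IsCherry c x y → PairsNested a b x y) → SplitRespects c a b := by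
    decide +kernel
  exact key c a b hab h

theorem CompatibleSplits.pairsNested {c d : Fin 5 → Bool} {a b x y : Fin 5}
    (h : CompatibleSplits c d) (hc : IsCherry c a b) (hd : IsCherry d x y) :
    PairsNested a b x y := by
  have hfresh : ∀ a b x : Fin 5, ∃ z, z ≠ a ∧ z ≠ b ∧ z ≠ x := by decide
  obtain ⟨p, q, h⟩ := h
  obtain ⟨hab, hab', hc⟩ := hc
  obtain ⟨hxy, hxy', hd⟩ := hd
  obtain ⟨z, hz⟩ := hfresh a b x
  obtain ⟨z', hz'⟩ := hfresh a b y
  unfold PairsNested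
  have := h a; have := h b; have := h x; have := h y; have := h z; have := h z'
  have := hc x; have := hc y; have := hc z; have := hc z'
  have := hd a; have := hd b; have := hd z; have := hd z'
  clear h hc hd hfresh
  cases p <;> cases q <;> cases hca : c a <;> cases hdx : d x <;> grind

theorem exists_respected_pairs {ι : Type*} (c : ι → Fin 5 → Bool)
    (h : ∀ i j, CompatibleSplits (c i) (c j)) :
    ∃ a a' b b' : Fin 5, a ≠ a' ∧ a ≠ b ∧ a ≠ b' ∧ a' ≠ b ∧ a' ≠ b' ∧ b ≠ b' ∧
      ∀ i, SplitRespects (c i) a a' ∧ SplitRespects (c i) b b' := by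
  have hfresh : ∀ a b : Fin 5, ∃ x y, x ≠ y ∧ x ≠ a ∧ x ≠ b ∧ y ≠ a ∧ y ≠ b := by decide
  by_cases h0 : ∃ i a b, IsCherry (c i) a b
  · obtain ⟨i, a, b, hi⟩ := h0
    by_cases h1 : ∃ j x y, IsCherry (c j) x y ∧ x ≠ a ∧ x ≠ b ∧ y ≠ a ∧ y ≠ b
    · obtain ⟨j, x, y, hj, hxa, hxb, hya, hyb⟩ := h1
      exact ⟨a, b, x, y, hi.1, hxa.symm, hya.symm, hxb.symm, hyb.symm, hj.1, fun k =>
        ⟨.of_forall_isCherry hi.1 fun u v hk => (h i k).pairsNested hi hk,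
          .of_forall_isCherry hj.1 fun u v hk => (h j k).pairsNested hj hk⟩⟩
    · obtain ⟨x, y, hxy, hxa, hxb, hya, hyb⟩ := hfresh a b
      refine ⟨a, b, x, y, hi.1, hxa.symm, hya.symm, hxb.symm, hyb.symm, hxy, fun k =>
        ⟨.of_forall_isCherry hi.1 fun u v hk => (h i k).pairsNested hi hk,
          .of_forall_isCherry hxy fun u v hk => ?_⟩⟩
      rcases (h i k).pairsNested hi hk with ⟨rfl, rfl⟩ | ⟨rfl, rfl⟩ | hk'
      · exact .inr (.inr ⟨hxa.symm, hya.symm, hxb.symm, hyb.symm⟩)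
      · exact .inr (.inr ⟨hxb.symm, hyb.symm, hxa.symm, hya.symm⟩)
      · exact absurd ⟨k, u, v, hk, hk'⟩ h1
  · refine ⟨0, 1, 2, 3, by decide, by decide, by decide, by decide, by decide, by decide,
      fun i => ⟨.of_forall_isCherry (by decide) fun u v hk => ?_,
        .of_forall_isCherry (by decide) fun u v hk => ?_⟩⟩ <;>
    exact absurd ⟨i, u, v, hk⟩ h0

theorem WeightedTree.exists_starTriple (T : WeightedTree 5) (D : Finset (Fin 5) → ℝ)
    (hD : ∀ i j k : Fin 5, i ≠ j → i ≠ k → j ≠ k → D {i, j, k} = T.D {i, j, k}) :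
    ∃ α α' β β' : Fin 5, α ≠ α' ∧ α ≠ β ∧ α ≠ β' ∧ α' ≠ β ∧ α' ≠ β' ∧ β ≠ β' ∧
        StarTriple D α α' ∧ StarTriple D β β' := by
  have hex : ∀ e : Sym2 T.V, ∃ c, e ∈ T.G.edgeSet → T.G.IsSplit e c := fun e => by
    by_cases he : e ∈ T.G.edgeSet
    · exact (T.isTree.isAcyclic.exists_isSplit he).imp fun _ h _ => h
    · exact ⟨fun _ => true, fun h => absurd h he⟩
  choose c hc using hex
  obtain ⟨a, a', b, b', h1, h2, h3, h4, h5, h6, hr⟩ :=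
    exists_respected_pairs (fun e : T.G.edgeSet => c e ∘ T.leaf) fun e f => by
      by_cases hef : (e : Sym2 T.V) = f
      · exact ⟨true, false, fun i hi => by simp_all⟩
      · obtain ⟨p, q, h⟩ :=
          (hc e e.2).compatible T.isTree.connected (hc f f.2) f.2 hef
        exact ⟨p, q, fun i => h _⟩
  have star : ∀ a b, (∀ e : T.G.edgeSet, SplitRespects (c e ∘ T.leaf) a b) →
      StarTriple D a b := fun a b hr => by
    have hk : ∀ e : Sym2 T.V, ∃ k : ℝ, e ∈ T.G.edgeSet → ∀ x y, x ≠ a → x ≠ b → y ≠ a → y ≠ b →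
      (if Separates (c e ∘ T.leaf) {a, x, y} then T.w e else 0) -
        (if Separates (c e ∘ T.leaf) {b, x, y} then T.w e else 0) = k := fun e => by
      by_cases he : e ∈ T.G.edgeSet
      · exact ((hr ⟨e, he⟩).exists_const (T.w e)).imp fun _ h _ => h
      · exact ⟨0, fun h => absurd h he⟩
    choose k hk using hk
    refine ⟨∑ e ∈ T.G.edgeFinset, k e, fun x y hxy hxa hxb hya hyb => ?_⟩
    rw [hD _ _ _ hxa.symm hya.symm hxy, hD _ _ _ hxb.symm hyb.symm hxy, T.D_eq_sum c hc,
      T.D_eq_sum c hc, ← Finset.sum_sub_distrib]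
    exact Finset.sum_congr rfl fun e he => hk e (mem_edgeFinset.1 he) x y hxa hxb hya hyb
  exact ⟨a, a', b, b', h1, h2, h3, h4, h5, h6, star _ _ fun e => (hr e).1,
    star _ _ fun e => (hr e).2⟩

namespace Caterpillar

/-- The parent of a non-root vertex of the caterpillar with leaves `0, …, 4`, cherries `{0, 1}`
and `{2, 3}`, and root `7`. -/
def parent : Fin 7 → Fin 8 := ![5, 5, 6, 6, 7, 7, 7]

/-- The edge joining a vertex to its parent. -/
def edge (k : Fin 7) : Sym2 (Fin 8) := s(k.castSucc, parent k)

/-- The caterpillar with five leaves. -/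
def graph : SimpleGraph (Fin 8) where
  Adj x y := ∃ k, s(x, y) = edge k
  symm := ⟨fun x y ⟨k, h⟩ => ⟨k, Sym2.eq_swap.trans h⟩⟩
  loopless := ⟨by unfold edge; decide⟩

instance : DecidableRel graph.Adj := fun x y => by
  unfold graph; infer_instance

/-- The indicator function of the descendants of `k`. -/
def descendant (k : Fin 7) (x : Fin 8) : Bool :=
  x = k.castSucc ∨ ∃ j : Fin 7, x = j.castSucc ∧ parent j = k.castSucc

theorem edge_injective : Function.Injective edge := by
  unfold Function.Injective; decide

theorem edgeFinset_eq : graph.edgeFinset = Finset.univ.image edge := by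
  ext e
  induction e with | _ x y =>
  rw [mem_edgeFinset, mem_edgeSet, Finset.mem_image]
  simp [graph, eq_comm]

theorem isSplit (k : Fin 7) : graph.IsSplit (edge k) (descendant k) := by
  unfold SimpleGraph.IsSplit
  revert k
  decide +kernel

theorem isTree : graph.IsTree := by
  rw [isTree_iff_connected_and_card]
  constructor
  · have h : ∀ k : Fin 7, graph.Reachable k.castSucc (parent k) := fun k =>
      Adj.reachable ⟨k, rfl⟩
    have h5 : graph.Reachable 5 7 := h 5
    have h6 : graph.Reachable 6 7 := h 6
    have key : ∀ x, graph.Reachable x 7 := by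
      intro x
      fin_cases x
      exacts [(h 0).trans h5, (h 1).trans h5, (h 2).trans h6, (h 3).trans h6, h 4, h5, h6, .rfl]
    exact { preconnected := fun x y => (key x).trans (key y).symm }
  · rw [Nat.card_eq_fintype_card, ← edgeFinset_card, edgeFinset_eq,
      Finset.card_image_of_injective _ edge_injective]
    simp

/-- The weighted caterpillar whose leaves are labelled through `σ`. -/
noncomputable def tree (σ : Equiv.Perm (Fin 5)) (wt : Fin 7 → ℝ) : WeightedTree 5 where
  V := Fin 8
  G := graph
  isTree := isTree
  w := Function.extend edge wt 0
  leaf i := Fin.castLE (by decide) (σ.symm i)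
  leaf_inj := (Fin.castLE_injective (by decide : 5 ≤ 8)).comp σ.symm.injective
  leaf_iff v := by
    rw [σ.symm.exists_congr_left]
    simp only [Equiv.symm_symm, Equiv.symm_apply_apply]
    revert v
    decide +kernel

theorem tree_D (σ : Equiv.Perm (Fin 5)) (wt : Fin 7 → ℝ) (S : Finset (Fin 5)) :
    (tree σ wt).D (S.map σ.toEmbedding) =
      ∑ k, if Separates (descendant k ∘ Fin.castLE (by decide)) S then wt k else 0 := by
  classical
  have hc : ∀ e ∈ graph.edgeSet, graph.IsSplit e
      (Function.extend edge descendant (fun _ _ => true) e) := by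
    intro e he
    rw [← mem_edgeFinset, edgeFinset_eq, Finset.mem_image] at he
    obtain ⟨k, -, rfl⟩ := he
    rw [edge_injective.extend_apply]
    exact isSplit k
  refine ((tree σ wt).D_eq_sum _ hc _).trans ?_
  change ∑ e ∈ graph.edgeFinset, _ = _
  rw [edgeFinset_eq, Finset.sum_image edge_injective.injOn]
  refine Finset.sum_congr rfl fun k _ => ?_
  rw [edge_injective.extend_apply]
  have hw : (tree σ wt).w (edge k) = wt k := edge_injective.extend_apply _ _ _
  rw [hw]
  congr 1
  simp only [Separates, tree, Finset.mem_map_equiv, Function.comp_apply, eq_iff_iff]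
  constructor
  · rintro ⟨i, hi, j, hj, h⟩
    exact ⟨_, hi, _, hj, h⟩
  · rintro ⟨i, hi, j, hj, h⟩
    exact ⟨σ i, by simpa, σ j, by simpa, by simpa⟩

end Caterpillar

theorem exists_perm_of_distinct {a a' b b' : Fin 5} (h1 : a ≠ a') (h2 : a ≠ b) (h3 : a ≠ b')
    (h4 : a' ≠ b) (h5 : a' ≠ b') (h6 : b ≠ b') :
    ∃ σ : Equiv.Perm (Fin 5), σ 0 = a ∧ σ 1 = a' ∧ σ 2 = b ∧ σ 3 = b' := by
  have hfresh : ∀ a a' b b' : Fin 5, ∃ z, z ≠ a ∧ z ≠ a' ∧ z ≠ b ∧ z ≠ b' := by decide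
  obtain ⟨z, hz1, hz2, hz3, hz4⟩ := hfresh a a' b b'
  have hinj : Function.Injective ![a, a', b, b', z] := by
    intro i j hij
    fin_cases i <;> fin_cases j <;> simp_all
  exact ⟨Equiv.ofBijective _ (Finite.injective_iff_bijective.1 hinj), rfl, rfl, rfl, rfl⟩

theorem exists_tree_of_starTriple (D : Finset (Fin 5) → ℝ) (σ : Equiv.Perm (Fin 5))
    (h : StarTriple D (σ 0) (σ 1)) (h' : StarTriple D (σ 2) (σ 3)) :
    ∃ T : WeightedTree 5, ∀ i j k : Fin 5, i ≠ j → i ≠ k → j ≠ k →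
      D {i, j, k} = T.D {i, j, k} := by
  obtain ⟨c, h⟩ := h
  obtain ⟨d, h'⟩ := h'
  set E : Finset (Fin 5) → ℝ := fun S => D (S.map σ.toEmbedding) with hE
  have hc : ∀ x y : Fin 5, x ≠ y → x ≠ 0 → x ≠ 1 → y ≠ 0 → y ≠ 1 →
      E {0, x, y} - E {1, x, y} = c := fun x y h1 h2 h3 h4 h5 => by
    simpa [hE] using h (σ x) (σ y) (by simpa) (by simpa) (by simpa) (by simpa) (by simpa)
  have hd : ∀ x y : Fin 5, x ≠ y → x ≠ 2 → x ≠ 3 → y ≠ 2 → y ≠ 3 →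
      E {2, x, y} - E {3, x, y} = d := fun x y h1 h2 h3 h4 h5 => by
    simpa [hE] using h' (σ x) (σ y) (by simpa) (by simpa) (by simpa) (by simpa) (by simpa)
  have c1 := hc 2 3 (by decide) (by decide) (by decide) (by decide) (by decide)
  have c2 := hc 2 4 (by decide) (by decide) (by decide) (by decide) (by decide)
  have c3 := hc 3 4 (by decide) (by decide) (by decide) (by decide) (by decide)
  have d1 := hd 0 1 (by decide) (by decide) (by decide) (by decide) (by decide)
  have d2 := hd 0 4 (by decide) (by decide) (by decide) (by decide) (by decide)
  rw [show ({2, 0, 1} : Finset (Fin 5)) = {0, 1, 2} by decide,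
    show ({3, 0, 1} : Finset (Fin 5)) = {0, 1, 3} by decide] at d1
  rw [show ({2, 0, 4} : Finset (Fin 5)) = {0, 2, 4} by decide,
    show ({3, 0, 4} : Finset (Fin 5)) = {0, 3, 4} by decide] at d2
  set g : ℝ := (E {2, 3, 4} + E {0, 1, 4} + E {0, 2, 4} - E {0, 1, 2} - E {0, 2, 3}) / 3 with hg
  set a' : ℝ := g + E {0, 1, 2} - E {0, 2, 4} with ha'
  set b' : ℝ := g + E {0, 2, 3} - E {0, 2, 4} with hb'
  set p : ℝ := E {0, 2, 4} - E {2, 3, 4} - (a' + c) + b' with hp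
  set q : ℝ := E {0, 2, 4} - E {0, 1, 4} - (b' + d) + a' with hq
  have key : ∀ S : Finset (Fin 5), S.card = 3 → E S = ∑ k : Fin 7,
      if Separates (Caterpillar.descendant k ∘ Fin.castLE (by decide)) S then
        ![a' + c, a', b' + d, b', g, p, q] k else 0 := by
    intro S hS
    have hmem : ∀ S : Finset (Fin 5), S.card = 3 → S ∈ ([{0, 1, 2}, {0, 1, 3}, {0, 1, 4},
        {0, 2, 3}, {0, 2, 4}, {0, 3, 4}, {1, 2, 3}, {1, 2, 4}, {1, 3, 4}, {2, 3, 4}] :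
        List (Finset (Fin 5))) := by decide +kernel
    have hS' := hmem S hS
    simp only [List.mem_cons, List.not_mem_nil, or_false] at hS'
    rw [Fin.sum_univ_seven]
    rcases hS' with rfl | rfl | rfl | rfl | rfl | rfl | rfl | rfl | rfl | rfl <;>
      simp +decide only [if_true, if_false, Matrix.cons_val] <;> linarith
  refine ⟨Caterpillar.tree σ ![a' + c, a', b' + d, b', g, p, q], fun i j k hij hik hjk => ?_⟩
  have hmap : ({i, j, k} : Finset (Fin 5)) =
      ({σ.symm i, σ.symm j, σ.symm k} : Finset (Fin 5)).map σ.toEmbedding := by simp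
  rw [hmap, Caterpillar.tree_D, ← key _ (Finset.card_eq_three.2
    ⟨_, _, _, by simpa, by simpa, by simpa, rfl⟩)]

/-- A family of real numbers indexed by the `3`-subsets of `[5]`
is the family of triple weights of a weighted tree iff there are four distinct
elements `α, α', β, β'` with `∗^{α,α'}` and `∗^{β,β'}`. -/
theorem triple_weights_of_five (D : Finset (Fin 5) → ℝ) :
    (∃ T : WeightedTree 5, ∀ i j k : Fin 5, i ≠ j → i ≠ k → j ≠ k →
        D {i, j, k} = T.D {i, j, k}) ↔
      ∃ α α' β β' : Fin 5, α ≠ α' ∧ α ≠ β ∧ α ≠ β' ∧ α' ≠ β ∧ α' ≠ β' ∧ β ≠ β' ∧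
        StarTriple D α α' ∧ StarTriple D β β' := by
  constructor
  · rintro ⟨T, hT⟩
    exact T.exists_starTriple D hT
  · rintro ⟨a, a', b, b', h1, h2, h3, h4, h5, h6, ha, hb⟩
    obtain ⟨σ, rfl, rfl, rfl, rfl⟩ := exists_perm_of_distinct h1 h2 h3 h4 h5 h6
    exact exists_tree_of_starTriple D σ ha hb
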